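/- arXiv:1803.02275 — 2 statements merged into one kernel-verified Lean document; each statement's English description precedes it below -/
import Mathlib

section
/- Let (X,𝒦) be a connectivity space. There exists a Grothendieck topology J on the poset category (𝒦,⊆) such that, for every A ∈ 𝒦, a sieve σ on A is a J-covering sieve if and only if [σ̇] = 𝒦 ∩ 𝒫(A), where σ̇ denotes the set of connected sets B ⊆ A belonging to σ. -/
open CategoryTheory

/-- A connectivity structure on `X`: contains `∅`, and is stable under unions of
families with nonempty intersection. -/
def IsConnStruct {X : Type} (K : Set (Set X)) : Prop :=
  ∅ ∈ K ∧ ∀ S : Set (Set X), S ⊆ K → (⋂₀ S).Nonempty → ⋃₀ S ∈ K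

/-- The connectivity structure generated by a collection `C` of subsets of `X`. -/
def genConn {X : Type} (C : Set (Set X)) : Set (Set X) :=
  ⋂₀ {L | IsConnStruct L ∧ C ⊆ L}

/-- The set `σ̇` of elements of a sieve `σ` on `A` in the poset category `𝒦`. -/
def sieveSet {X : Type} {K : Set (Set X)} {A : ↥K} (σ : Sieve A) : Set (Set X) :=
  {B | ∃ (hB : B ∈ K) (hle : (⟨B, hB⟩ : ↥K) ≤ A), σ.arrows (homOfLE hle)}


theorem genConn_isConn {X : Type} (C : Set (Set X)) : IsConnStruct (genConn C) := by
  refine ⟨fun L hL => hL.1.1, fun S hS hne L hL => hL.1.2 S (fun s hs => hS hs L hL) hne⟩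

theorem subset_genConn {X : Type} (C : Set (Set X)) : C ⊆ genConn C :=
  fun _ hc _ hL => hL.2 hc

theorem genConn_min {X : Type} {C L : Set (Set X)} (hL : IsConnStruct L) (h : C ⊆ L) :
    genConn C ⊆ L := fun _ hx => hx L ⟨hL, h⟩

theorem genConn_mono {X : Type} {C D : Set (Set X)} (h : C ⊆ D) : genConn C ⊆ genConn D :=
  genConn_min (genConn_isConn D) (h.trans (subset_genConn D))

theorem mem_genConn_local {X : Type} {C : Set (Set X)} {D : Set X} (h : D ∈ genConn C) :
    D ∈ genConn (C ∩ Set.powerset D) := by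
  refine genConn_min (L := {D | D ∈ genConn (C ∩ Set.powerset D)}) ⟨?_, ?_⟩ ?_ h
  · exact (genConn_isConn _).1
  · intro S hS hne
    refine (genConn_isConn _).2 S (fun s hs => ?_) hne
    refine genConn_mono ?_ (hS hs)
    exact fun t ht => ⟨ht.1, Set.Subset.trans ht.2 (Set.subset_sUnion_of_mem hs)⟩
  · exact fun c hc => subset_genConn _ ⟨hc, Set.Subset.refl c⟩

theorem cover_iff {X : Type} {K : Set (Set X)} (hK : IsConnStruct K) {A : ↥K} (σ : Sieve A) :
    genConn (sieveSet σ) = K ∩ Set.powerset A.1 ↔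
      K ∩ Set.powerset A.1 ⊆ genConn (sieveSet σ) := by
  refine ⟨fun h => h.ge, fun h => Set.Subset.antisymm (genConn_min ⟨?_, ?_⟩ ?_) h⟩
  · exact ⟨hK.1, Set.empty_subset _⟩
  · exact fun S hS hne => ⟨hK.2 S (fun s hs => (hS hs).1) hne,
      Set.sUnion_subset fun s hs => (hS hs).2⟩
  · rintro B ⟨hB, hle, -⟩
    exact ⟨hB, hle⟩

theorem stmt3 {X : Type} (K : Set (Set X)) (hK : IsConnStruct K) :
    ∃ J : GrothendieckTopology ↥K,
      ∀ (A : ↥K) (σ : Sieve A),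
        σ ∈ J A ↔ genConn (sieveSet σ) = K ∩ Set.powerset A.1 := by
  refine ⟨{ sieves := fun A => {σ | genConn (sieveSet σ) = K ∩ Set.powerset A.1}
            top_mem' := ?_
            pullback_stable' := ?_
            transitive' := ?_ }, fun A σ => Iff.rfl⟩
  · intro A
    refine (cover_iff hK _).2 fun B hB => subset_genConn _ ⟨hB.1, hB.2, trivial⟩
  · intro A B σ f hσ
    refine (cover_iff hK _).2 fun D hD => ?_
    have hσ' := (cover_iff hK _).1 hσ
    have hBA : B.1 ⊆ A.1 := leOfHom f
    have h1 := mem_genConn_local (hσ' ⟨hD.1, Set.Subset.trans hD.2 hBA⟩)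
    refine genConn_mono ?_ h1
    rintro E ⟨⟨hE, hle, h⟩, hED⟩
    exact ⟨hE, Set.Subset.trans hED hD.2, h⟩
  · intro A σ hσ R hR
    refine (cover_iff hK _).2 (Set.Subset.trans ((cover_iff hK _).1 hσ) ?_)
    refine genConn_min (genConn_isConn _) ?_
    rintro B ⟨hB, hle, h⟩
    have h1 := (cover_iff hK _).1 (hR h) ⟨hB, Set.Subset.refl B⟩
    refine genConn_mono ?_ h1
    rintro E ⟨hE, hEB, h2⟩
    exact ⟨hE, Set.Subset.trans hEB hle, h2⟩
end

section
/- Let (X,𝒦) be a finite connectivity space, with J the Grothendieck topology on the poset category (𝒦,⊆) whose covering sieves on A ∈ 𝒦 are the sieves σ with [σ̇] = 𝒦 ∩ 𝒫(A). Then there exists a finite sober topological space T such that the category of sheaves of types on the site (𝒦,J) is equivalent to the category of sheaves of types on T (for the usual Grothendieck topology on the poset of open sets of T); moreover T is unique up to homeomorphism: any two finite sober topological spaces whose sheaf categories are both equivalent to that of (𝒦,J) are homeomorphic. -/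
open CategoryTheory TopologicalSpace

/-- `(T, tT)` is a sober topological space: T0 and every nonempty irreducible
closed set is the closure of a point. -/
def SoberP (T : Type) (tT : TopologicalSpace T) : Prop :=
  letI := tT
  T0Space T ∧ QuasiSober T

/-- The category of sheaves of types on the site `(𝒦, J)` is equivalent to the
category of sheaves of types on the topological space `(T, tT)`. -/
def SheafEquivP {X : Type} {K : Set (Set X)} (J : GrothendieckTopology ↥K)
    (T : Type) (tT : TopologicalSpace T) : Prop :=
  letI := tT
  Nonempty (Sheaf J (Type) ≌ Sheaf (Opens.grothendieckTopology T) (Type))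

open Opposite

section Uniq
variable {T : Type} [TopologicalSpace T]

instance opensSubcanonical : (Opens.grothendieckTopology T).Subcanonical := by
  apply GrothendieckTopology.Subcanonical.of_isSheaf_yoneda_obj
  intro X U S hS x hx
  have hle : U ≤ X := by
    intro t ht
    obtain ⟨V, f, hf, hV⟩ := hS t ht
    exact (x f hf).le hV
  refine ⟨homOfLE hle, ?_, ?_⟩
  · intro V f hf
    exact Subsingleton.elim (α := (V ⟶ X)) _ _
  · intro y _
    exact Subsingleton.elim (α := (U ⟶ X)) _ _

/-- The representable sheaf. -/
noncomputable abbrev yS (U : Opens T) : Sheaf (Opens.grothendieckTopology T) (Type) :=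
  (Opens.grothendieckTopology T).yoneda.obj U

lemma yS_le_iff (U V : Opens T) : Nonempty (yS U ⟶ yS V) ↔ U ≤ V := by
  constructor
  · rintro ⟨f⟩
    exact ((Opens.grothendieckTopology T).yonedaFullyFaithful.preimage f).le
  · intro h
    exact ⟨(Opens.grothendieckTopology T).yoneda.map (homOfLE h)⟩

lemma yS_subterminal (U : Opens T) (G : Sheaf (Opens.grothendieckTopology T) (Type)) :
    Subsingleton (G ⟶ yS U) := by
  constructor
  intro f g
  apply Sheaf.hom_ext
  ext V x
  exact Subsingleton.elim (α := (unop V ⟶ U)) _ _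

/-- Maps out of a representable. -/
def fromElt (F : Sheaf (Opens.grothendieckTopology T) (Type)) (U : Opens T)
    (x : F.obj.obj (op U)) : yS U ⟶ F :=
  ⟨yonedaEquiv.symm x⟩

lemma exists_rep (F : Sheaf (Opens.grothendieckTopology T) (Type))
    (hF : ∀ G, Subsingleton (G ⟶ F)) :
    ∃ W, Nonempty (yS W ⟶ F) ∧ Nonempty (F ⟶ yS W) := by
  have hsub : ∀ U, Subsingleton (F.obj.obj (op U)) := by
    intro U
    constructor
    intro x y
    have h := (hF (yS U)).elim (fromElt F U x) (fromElt F U y)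
    have h2 : (yonedaEquiv.symm x : yoneda.obj U ⟶ F.obj) = yonedaEquiv.symm y :=
      congrArg (fun k => k.hom) h
    exact yonedaEquiv.symm.injective h2
  let W : Opens T := sSup {U | Nonempty (F.obj.obj (op U))}
  refine ⟨W, ?_, ?_⟩
  · have hsh := (isSheaf_iff_isSheaf_of_type _ _).1 F.property
    let S : Sieve W :=
      { arrows := fun V _ => Nonempty (F.obj.obj (op V))
        downward_closed := fun {_ _ _} ⟨x⟩ g => ⟨F.obj.map g.op x⟩ }
    have hS : S ∈ Opens.grothendieckTopology T W := by
      intro t ht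
      obtain ⟨U, hU, htU⟩ := Opens.mem_sSup.1 ht
      exact ⟨U, homOfLE (le_sSup hU), hU, htU⟩
    obtain ⟨x, -, -⟩ := hsh S hS (fun V f hf => Classical.choice hf)
      (fun _ _ _ _ _ _ _ _ _ _ => (hsub _).elim _ _)
    exact ⟨fromElt F W x⟩
  · exact ⟨⟨{ app := fun V => TypeCat.ofHom (fun x => homOfLE (le_sSup (⟨x⟩ : Nonempty (F.obj.obj (op (unop V))))))
              naturality := by
                intro A B f
                ext x
                exact Subsingleton.elim (α := (unop B ⟶ W)) _ _ }⟩⟩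

lemma exists_orderIso {T₁ T₂ : Type} [TopologicalSpace T₁] [TopologicalSpace T₂]
    (e : Sheaf (Opens.grothendieckTopology T₁) (Type) ≌
      Sheaf (Opens.grothendieckTopology T₂) (Type)) :
    Nonempty (Opens T₁ ≃o Opens T₂) := by
  have h1 : ∀ U : Opens T₁, ∃ W : Opens T₂, Nonempty (yS W ⟶ e.functor.obj (yS U)) ∧
      Nonempty (e.functor.obj (yS U) ⟶ yS W) := by
    intro U
    apply exists_rep
    intro G
    have : Subsingleton (e.symm.functor.obj G ⟶ yS U) := yS_subterminal U (e.inverse.obj G)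
    exact (e.symm.toAdjunction.homEquiv G (yS U)).symm.subsingleton
  have h2 : ∀ U : Opens T₂, ∃ W : Opens T₁, Nonempty (yS W ⟶ e.inverse.obj (yS U)) ∧
      Nonempty (e.inverse.obj (yS U) ⟶ yS W) := by
    intro U
    apply exists_rep
    intro G
    have := yS_subterminal U (e.functor.obj G)
    exact (e.toAdjunction.homEquiv G (yS U)).symm.subsingleton
  choose φ a b using h1
  choose ψ c d using h2
  have hle : ∀ U V, φ U ≤ φ V ↔ U ≤ V := by
    intro U V
    obtain ⟨aU⟩ := a U
    obtain ⟨bU⟩ := b U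
    obtain ⟨aV⟩ := a V
    obtain ⟨bV⟩ := b V
    rw [← yS_le_iff, ← yS_le_iff]
    constructor
    · rintro ⟨f⟩
      exact ⟨e.functor.preimage (bU ≫ f ≫ aV)⟩
    · rintro ⟨f⟩
      exact ⟨aU ≫ e.functor.map f ≫ bV⟩
  have hs : Function.Surjective φ := by
    intro V
    obtain ⟨cV⟩ := c V
    obtain ⟨dV⟩ := d V
    obtain ⟨aU⟩ := a (ψ V)
    obtain ⟨bU⟩ := b (ψ V)
    refine ⟨ψ V, le_antisymm ?_ ?_⟩
    · exact (yS_le_iff _ _).1 ⟨aU ≫ e.functor.map cV ≫ e.counit.app _⟩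
    · exact (yS_le_iff _ _).1 ⟨e.counitInv.app _ ≫ e.functor.map dV ≫ bU⟩
  exact ⟨RelIso.ofSurjective (OrderEmbedding.ofMapLEIff φ hle) hs⟩

lemma exists_point {T₁ T₂ : Type} [TopologicalSpace T₁] [TopologicalSpace T₂] [QuasiSober T₂]
    (e : Opens T₁ ≃o Opens T₂) (x : T₁) : ∃ y : T₂, ∀ V : Opens T₂, y ∈ V ↔ x ∈ e.symm V := by
  let N : Opens T₁ := ⟨(closure {x})ᶜ, isClosed_closure.isOpen_compl⟩
  have hN : ∀ U : Opens T₁, ¬ U ≤ N ↔ x ∈ U := by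
    intro U
    constructor
    · intro h
      by_contra hx
      apply h
      intro t ht htc
      obtain ⟨z, hz, hz2⟩ := mem_closure_iff.1 htc U U.2 ht
      rw [Set.mem_singleton_iff] at hz2
      exact hx (hz2 ▸ hz)
    · intro hx h
      exact h hx (subset_closure rfl)
  have key : ∀ V : Opens T₂, (((e N : Set T₂)ᶜ) ∩ V).Nonempty ↔ x ∈ e.symm V := by
    intro V
    rw [← hN, ← e.le_iff_le, e.apply_symm_apply]
    constructor
    · rintro ⟨t, ht, htV⟩ h
      exact ht (h htV)
    · intro h
      obtain ⟨t, ht, ht2⟩ := Set.not_subset.1 h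
      exact ⟨t, ht2, ht⟩
  have hirr : IsIrreducible ((e N : Set T₂)ᶜ) := by
    constructor
    · obtain ⟨t, ht, -⟩ := (key ⊤).2 (by simp)
      exact ⟨t, ht⟩
    · intro u v hu hv h1 h2
      have := (key (⟨u, hu⟩ ⊓ ⟨v, hv⟩)).2 (by
        rw [map_inf]
        exact ⟨(key ⟨u, hu⟩).1 h1, (key ⟨v, hv⟩).1 h2⟩)
      exact this
  obtain ⟨y, hy⟩ := QuasiSober.sober hirr (e N).2.isClosed_compl
  refine ⟨y, fun V => ?_⟩
  rw [← key]
  exact hy.mem_open_set_iff V.2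

lemma homeo_of_orderIso {T₁ T₂ : Type} [TopologicalSpace T₁] [TopologicalSpace T₂]
    [QuasiSober T₁] [QuasiSober T₂] [T0Space T₁] [T0Space T₂]
    (e : Opens T₁ ≃o Opens T₂) : Nonempty (T₁ ≃ₜ T₂) := by
  choose f hf using exists_point e
  choose g hg using exists_point e.symm
  refine ⟨⟨⟨f, g, ?_, ?_⟩, ?_, ?_⟩⟩
  · intro x
    apply (t0Space_iff_inseparable T₁).1 inferInstance
    rw [inseparable_iff_forall_isOpen]
    intro s hs
    have := (hg (f x) ⟨s, hs⟩).trans (hf x _)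
    simpa using! this
  · intro x
    apply (t0Space_iff_inseparable T₂).1 inferInstance
    rw [inseparable_iff_forall_isOpen]
    intro s hs
    have := (hf (g x) ⟨s, hs⟩).trans (hg x _)
    simpa using! this
  · refine ⟨fun s hs => ?_⟩
    convert (e.symm ⟨s, hs⟩).2 using 1
    ext x
    exact hf x ⟨s, hs⟩
  · refine ⟨fun s hs => ?_⟩
    convert (e.symm.symm ⟨s, hs⟩).2 using 1
    ext x
    exact hg x ⟨s, hs⟩
end Uniq

section Exist
variable {P : Type} [PartialOrder P] [Finite P] (J : GrothendieckTopology P)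

/-- The irreducible objects of the site. -/
abbrev IrrP : Type := {p : P // ∀ S ∈ J p, S = ⊤}

/-- The topology of lower sets. -/
def lowTop (Q : Type) [PartialOrder Q] : TopologicalSpace Q where
  IsOpen s := IsLowerSet s
  isOpen_univ := isLowerSet_univ
  isOpen_inter _ _ h1 h2 := h1.inter h2
  isOpen_sUnion _ h := isLowerSet_sUnion h

lemma lowTop_sober (Q : Type) [PartialOrder Q] [Finite Q] : SoberP Q (lowTop Q) := by
  letI := lowTop Q
  refine ⟨?_, ?_⟩
  · rw [t0Space_iff_inseparable]
    intro x y h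
    rw [inseparable_iff_forall_isOpen] at h
    apply le_antisymm
    · exact (h (Set.Iic y) (isLowerSet_Iic y)).2 le_rfl
    · exact (h (Set.Iic x) (isLowerSet_Iic x)).1 le_rfl
  · refine ⟨fun {S} hS hc => ?_⟩
    classical
    obtain ⟨z, hz, hSz⟩ := isIrreducible_iff_sUnion_isClosed.1 hS
      (Set.toFinite ((fun x => closure {x}) '' S)).toFinset
      (by
        intro z hz
        simp only [Set.Finite.mem_toFinset] at hz
        obtain ⟨x, -, rfl⟩ := hz
        exact isClosed_closure)
      (by
        intro x hx
        refine ⟨closure {x}, ?_, subset_closure rfl⟩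
        simp only [Set.Finite.coe_toFinset]
        exact ⟨x, hx, rfl⟩)
    simp only [Set.Finite.mem_toFinset] at hz
    obtain ⟨x, hx, rfl⟩ := hz
    exact ⟨x, Set.Subset.antisymm (hc.closure_subset_iff.2 (by simpa using hx)) hSz⟩

/-- Inclusion of the irreducible objects. -/
def inclP : IrrP J ⥤ P := (Subtype.mono_coe (fun p : P => ∀ S ∈ J p, S = ⊤)).functor

instance : (inclP J).Full := ⟨fun f => ⟨homOfLE f.le, Subsingleton.elim _ _⟩⟩
instance : (inclP J).Faithful := ⟨fun _ => Subsingleton.elim _ _⟩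

lemma inclP_cover (A : P) : Sieve.coverByImage (inclP J) A ∈ J A := by
  induction A using WellFoundedLT.induction with
  | ind A ih =>
    by_cases hA : ∀ S ∈ J A, S = ⊤
    · have : Sieve.coverByImage (inclP J) A = ⊤ := by
        rw [← Sieve.id_mem_iff_eq_top]
        exact Presieve.in_coverByImage (inclP J) (Y := (⟨A, hA⟩ : IrrP J)) (𝟙 A)
      rw [this]
      exact J.top_mem A
    · push Not at hA
      obtain ⟨S, hS, hne⟩ := hA
      refine J.transitive hS _ fun B f hf => ?_
      have hlt : B < A := by
        refine lt_of_le_of_ne f.le ?_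
        rintro rfl
        apply hne
        rw [← Sieve.id_mem_iff_eq_top]
        rwa [Subsingleton.elim f (𝟙 B)] at hf
      refine J.superset_covering ?_ (ih B hlt)
      rintro C g ⟨⟨Z, f₁, f₂, h⟩⟩
      exact ⟨⟨Z, f₁, f₂ ≫ f, Subsingleton.elim _ _⟩⟩

lemma pushforward_eq_top {C D : Type} [Category.{0} C] [Category.{0} D] (G : C ⥤ D) [G.Full]
    [G.Faithful] {X : C} {S : Sieve X}
    (h : S.functorPushforward G (𝟙 (G.obj X))) : S = ⊤ := by
  rw [← Sieve.id_mem_iff_eq_top]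
  obtain ⟨Y, f, g, hf, hfg⟩ := h
  obtain ⟨k, rfl⟩ := G.map_surjective g
  have : k ≫ f = 𝟙 X := G.map_injective (by simpa using hfg.symm)
  rw [← this]
  exact S.downward_closed hf k

instance : (inclP J).IsDenseSubsite ⊥ J where
  isCoverDense' := ⟨inclP_cover J⟩
  functorPushforward_mem_iff {X S} := by
    rw [GrothendieckTopology.bot_covering]
    constructor
    · intro h
      have h2 := X.2 _ h
      apply pushforward_eq_top (inclP J)
      rw [h2]
      trivial
    · rintro rfl
      rw [Sieve.functorPushforward_top]
      exact J.top_mem _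

section
variable (Q : Type) [PartialOrder Q]
attribute [local instance] lowTop

/-- Principal lower sets as opens. -/
def prinOpen : Q ⥤ Opens Q :=
  Monotone.functor (f := fun q => (⟨Set.Iic q, isLowerSet_Iic q⟩ : Opens Q))
    (fun _ _ h => Set.Iic_subset_Iic.2 h)

instance : (prinOpen Q).Full :=
  ⟨fun f => ⟨homOfLE (f.le (show _ ∈ Set.Iic _ from le_rfl)), Subsingleton.elim _ _⟩⟩
instance : (prinOpen Q).Faithful := ⟨fun _ => Subsingleton.elim _ _⟩

instance : (prinOpen Q).IsDenseSubsite ⊥ (Opens.grothendieckTopology Q) where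
  isCoverDense' := ⟨by
    intro U x hx
    have hle : (prinOpen Q).obj x ≤ U := fun y hy => U.2 hy hx
    exact ⟨(prinOpen Q).obj x, homOfLE hle, Presieve.in_coverByImage _ _,
      show x ∈ Set.Iic x from le_rfl⟩⟩
  functorPushforward_mem_iff {X S} := by
    rw [GrothendieckTopology.bot_covering]
    constructor
    · intro h
      obtain ⟨U, f, hf, hXU⟩ := h X (show X ∈ Set.Iic X from le_rfl)
      apply pushforward_eq_top (prinOpen Q)
      have hle : (prinOpen Q).obj X ≤ U := fun y hy => U.2 hy hXU
      have := Sieve.downward_closed _ hf (homOfLE hle)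
      rwa [Subsingleton.elim (homOfLE hle ≫ f) (𝟙 _)] at this
    · rintro rfl
      rw [Sieve.functorPushforward_top]
      exact GrothendieckTopology.top_mem _ _

end

lemma exists_equiv : Nonempty (Sheaf J (Type) ≌
    @Sheaf _ _ (@Opens.grothendieckTopology (IrrP J) (lowTop (IrrP J))) (Type) _) := by
  letI := lowTop (IrrP J)
  exact ⟨(Functor.IsDenseSubsite.sheafEquiv ⊥ J (inclP J) (Type)).symm.trans
    (Functor.IsDenseSubsite.sheafEquiv ⊥
      (Opens.grothendieckTopology (IrrP J)) (prinOpen (IrrP J)) (Type))⟩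

end Exist

theorem stmt19 {X : Type} [Finite X] (K : Set (Set X)) (hK : IsConnStruct K)
    (J : GrothendieckTopology ↥K)
    (hJ : ∀ (A : ↥K) (σ : Sieve A),
      σ ∈ J A ↔ genConn (sieveSet σ) = K ∩ Set.powerset A.1) :
    (∃ (T : Type) (tT : TopologicalSpace T),
      Finite T ∧ SoberP T tT ∧ SheafEquivP J T tT) ∧
    (∀ (T₁ T₂ : Type) (t₁ : TopologicalSpace T₁) (t₂ : TopologicalSpace T₂),
      Finite T₁ → SoberP T₁ t₁ → SheafEquivP J T₁ t₁ →
      Finite T₂ → SoberP T₂ t₂ → SheafEquivP J T₂ t₂ →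
      Nonempty (@Homeomorph T₁ T₂ t₁ t₂)) := by
  refine ⟨⟨IrrP J, lowTop (IrrP J), inferInstance, lowTop_sober _, exists_equiv J⟩, ?_⟩
  intro T₁ T₂ t₁ t₂ _ h₁ e₁ _ h₂ e₂
  obtain ⟨e₁⟩ := e₁
  obtain ⟨e₂⟩ := e₂
  obtain ⟨_, _⟩ := h₁
  obtain ⟨_, _⟩ := h₂
  obtain ⟨e⟩ := exists_orderIso (e₁.symm.trans e₂)
  exact homeo_of_orderIso e
end
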